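/- Let n ≥ 2 and k ≥ 2 be integers. Let h_k : {1,…,n}^k → ℝ be the hitting-time solution for the target (2,…,2) ∈ {1,…,n}^k, and let h_{k−1} : {1,…,n}^{k−1} → ℝ be the hitting-time solution for the target (2,…,2) ∈ {1,…,n}^{k−1}. Then h_k((1,…,1)) = (k/(k−1))·h_{k−1}((1,…,1)) + (n−1)·n^{k−1}. -/

import Mathlib

open Finset

/-- `h` is the hitting-time solution for target `b` of the symmetric nearest-neighbor
random walk on the Hamming graph `{1,…,n}^m` (vertices differ in exactly one coordinate). -/
def IsHitSol {m n : ℕ} (b : Fin m → Fin n) (h : (Fin m → Fin n) → ℝ) : Prop :=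
  h b = 0 ∧ ∀ x, x ≠ b →
    h x = 1 + (1 / (((n : ℝ) - 1) * m)) *
      ∑ y ∈ univ.filter (fun y => hammingDist x y = 1), h y

section Neighbours

variable {m n : ℕ}

lemma hammingDist_update_self (x : Fin m → Fin n) {i : Fin m} {v : Fin n} (hv : v ≠ x i) :
    hammingDist x (Function.update x i v) = 1 := by
  rw [hammingDist, Finset.card_eq_one]
  refine ⟨i, ?_⟩
  ext j
  by_cases hj : j = i
  · subst hj
    simpa using hv.symm
  · simp [hj]

lemma hammingDist_update_add (x b : Fin m → Fin n) (i : Fin m) (v : Fin n) :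
    hammingDist (Function.update x i v) b + (if x i ≠ b i then 1 else 0) =
      hammingDist x b + (if v ≠ b i then 1 else 0) := by
  simp only [hammingDist, Finset.card_filter]
  rw [← Finset.add_sum_erase _ _ (mem_univ i),
    ← Finset.add_sum_erase (a := i) univ (fun j => if x j ≠ b j then 1 else 0) (mem_univ i)]
  have h : ∑ j ∈ univ.erase i, (if Function.update x i v j ≠ b j then 1 else 0) =
      ∑ j ∈ univ.erase i, (if x j ≠ b j then 1 else 0) :=
    Finset.sum_congr rfl fun j hj => by simp [Finset.ne_of_mem_erase hj]
  rw [h, Function.update_self]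
  ring

/-- The neighbours of `x` in the Hamming graph are its one-coordinate modifications. -/
lemma sum_hammingDist_eq_one (x : Fin m → Fin n) (F : (Fin m → Fin n) → ℝ) :
    ∑ y ∈ univ.filter (fun y => hammingDist x y = 1), F y =
      ∑ i, ∑ v ∈ univ.erase (x i), F (Function.update x i v) := by
  rw [Finset.sum_sigma']
  symm
  refine Finset.sum_bij (fun p _ => Function.update x p.1 p.2) ?_ ?_ ?_ (fun _ _ => rfl)
  · rintro ⟨i, v⟩ h
    simp only [mem_sigma, mem_univ, mem_erase, true_and, and_true] at h
    simpa using hammingDist_update_self x h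
  · rintro ⟨i, v⟩ h ⟨j, w⟩ h' heq
    simp only [mem_sigma, mem_univ, mem_erase, true_and, and_true] at h h' heq
    have hij : i = j := by
      by_contra hne
      have := congrFun heq i
      simp [hne] at this
      exact h this
    subst hij
    have := congrFun heq i
    simp at this
    rw [this]
  · intro y hy
    simp only [mem_filter, mem_univ, true_and, hammingDist, Finset.card_eq_one] at hy
    obtain ⟨i, hi⟩ := hy
    have hi' : ∀ j, x j ≠ y j ↔ j = i := fun j => by
      simpa using Finset.ext_iff.mp hi j
    refine ⟨⟨i, y i⟩, by simpa using Ne.symm ((hi' i).2 rfl), ?_⟩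
    ext j
    by_cases hj : j = i
    · subst hj
      simp
    · have : x j = y j := not_not.mp (mt (hi' j).1 hj)
      simp [hj, this]

lemma sum_hammingDist_eq_one_const (hn : 1 ≤ n) (x : Fin m → Fin n) (c : ℝ) :
    ∑ _y ∈ univ.filter (fun y => hammingDist x y = 1), c = ((n : ℝ) - 1) * m * c := by
  rw [sum_hammingDist_eq_one x (fun _ => c)]
  simp [Nat.cast_sub hn]
  ring

/-- Sum over the neighbours of `x` of a function of the distance to `b`. -/
lemma sum_neighbours_radial (hn : 2 ≤ n) (x b : Fin m → Fin n) (f : ℕ → ℝ) {d : ℕ}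
    (hd : hammingDist x b = d + 1) :
    ∑ y ∈ univ.filter (fun y => hammingDist x y = 1), f (hammingDist y b) =
      (d + 1) * (f d + ((n : ℝ) - 2) * f (d + 1)) +
        ((m : ℝ) - (d + 1)) * ((n : ℝ) - 1) * f (d + 2) := by
  rw [sum_hammingDist_eq_one]
  have inner : ∀ i, ∑ v ∈ univ.erase (x i), f (hammingDist (Function.update x i v) b) =
      if x i ≠ b i then f d + ((n : ℝ) - 2) * f (d + 1) else ((n : ℝ) - 1) * f (d + 2) := by
    intro i
    have key := hammingDist_update_add x b i
    split_ifs with hi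
    · rw [← Finset.add_sum_erase _ _ (show b i ∈ univ.erase (x i) by simp [Ne.symm hi])]
      have h1 : hammingDist (Function.update x i (b i)) b = d := by
        have := key (b i)
        simp [hi] at this
        omega
      have h2 : ∀ v ∈ (univ.erase (x i)).erase (b i),
          f (hammingDist (Function.update x i v) b) = f (d + 1) := by
        intro v hv
        have := key v
        simp [hi, Finset.ne_of_mem_erase hv] at this
        rw [this, hd]
      rw [h1, Finset.sum_congr rfl h2, Finset.sum_const, nsmul_eq_mul,
        Finset.card_erase_of_mem (by simp [Ne.symm hi]), Finset.card_erase_of_mem (mem_univ _),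
        Finset.card_univ, Fintype.card_fin, Nat.sub_sub, Nat.cast_sub hn]
      norm_num
    · rw [not_not] at hi
      have h2 : ∀ v ∈ univ.erase (x i),
          f (hammingDist (Function.update x i v) b) = f (d + 2) := by
        intro v hv
        have := key v
        have hvb : v ≠ b i := hi ▸ Finset.ne_of_mem_erase hv
        simp [hi, hvb] at this
        rw [this, hd]
      rw [Finset.sum_congr rfl h2, Finset.sum_const, nsmul_eq_mul,
        Finset.card_erase_of_mem (mem_univ _), Finset.card_univ, Fintype.card_fin,
        Nat.cast_sub (by omega)]
      norm_num
  rw [Finset.sum_congr rfl fun i _ => inner i, Finset.sum_ite, Finset.sum_const, Finset.sum_const,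
    nsmul_eq_mul, nsmul_eq_mul]
  have hcard : (univ.filter (fun i => x i ≠ b i)).card = d + 1 := hd
  have htot := Finset.card_filter_add_card_filter_not (s := (univ : Finset (Fin m)))
    (fun i => x i ≠ b i)
  rw [hcard, Finset.card_univ, Fintype.card_fin] at htot
  have htot' : ((d : ℝ) + 1) + (univ.filter (fun i => ¬x i ≠ b i)).card = m := by
    exact_mod_cast htot
  rw [hcard]
  push_cast
  linear_combination ((n : ℝ) - 1) * f (d + 2) * htot'

end Neighbours

section Uniqueness

variable {m n : ℕ}

/-- Maximum principle: a function harmonic off `b` attains its maximum at `b`. -/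
lemma le_of_harmonic_off (hn : 2 ≤ n) (b : Fin m → Fin n) (u : (Fin m → Fin n) → ℝ)
    (hu : ∀ x, x ≠ b → ((n : ℝ) - 1) * m * u x =
      ∑ y ∈ univ.filter (fun y => hammingDist x y = 1), u y) (x : Fin m → Fin n) :
    u x ≤ u b := by
  obtain ⟨z, -, hz⟩ := Finset.exists_max_image univ u ⟨x, mem_univ x⟩
  suffices h : ∀ d w, hammingDist w b = d → u w = u z → u b = u z from
    (h _ z rfl rfl).symm ▸ hz x (mem_univ x)
  intro d
  induction d with
  | zero =>
    intro w hw hwz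
    rwa [← hammingDist_eq_zero.mp hw]
  | succ d ih =>
    intro w hw hwz
    have hwb : w ≠ b := hammingDist_ne_zero.mp (by omega)
    obtain ⟨i, hi⟩ := Function.ne_iff.mp hwb
    have hsum : ∑ y ∈ univ.filter (fun y => hammingDist w y = 1), (u z - u y) = 0 := by
      rw [Finset.sum_sub_distrib, sum_hammingDist_eq_one_const (by omega), ← hu w hwb, hwz, sub_self]
    rw [Finset.sum_eq_zero_iff_of_nonneg
      (fun y _ => sub_nonneg.mpr (hz y (mem_univ y)))] at hsum
    have hval := hsum (Function.update w i (b i))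
      (by simpa using hammingDist_update_self w (Ne.symm hi))
    refine ih (Function.update w i (b i)) ?_ (sub_eq_zero.mp hval).symm
    have := hammingDist_update_add w b i (b i)
    simp [hi] at this
    omega

lemma IsHitSol.mul_eq {b : Fin m → Fin n} {h : (Fin m → Fin n) → ℝ} (hn : 2 ≤ n)
    (hh : IsHitSol b h) {x : Fin m → Fin n} (hx : x ≠ b) :
    ((n : ℝ) - 1) * m * h x = ((n : ℝ) - 1) * m +
      ∑ y ∈ univ.filter (fun y => hammingDist x y = 1), h y := by
  have hm : m ≠ 0 := by
    rintro rfl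
    exact hx (Subsingleton.elim _ _)
  have hn' : (n : ℝ) - 1 ≠ 0 := by
    have : (2 : ℝ) ≤ n := by exact_mod_cast hn
    linarith
  have hm' : (m : ℝ) ≠ 0 := by exact_mod_cast hm
  rw [hh.2 x hx]
  field_simp

lemma IsHitSol.unique {b : Fin m → Fin n} {h g : (Fin m → Fin n) → ℝ} (hn : 2 ≤ n)
    (hh : IsHitSol b h) (hg : g b = 0)
    (hg' : ∀ x, x ≠ b → ((n : ℝ) - 1) * m * g x = ((n : ℝ) - 1) * m +
      ∑ y ∈ univ.filter (fun y => hammingDist x y = 1), g y) : h = g := by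
  funext x
  have h1 := le_of_harmonic_off hn b (fun y => h y - g y) (fun x hx => by
    rw [Finset.sum_sub_distrib, mul_sub, hh.mul_eq hn hx, hg' x hx]; ring) x
  have h2 := le_of_harmonic_off hn b (fun y => g y - h y) (fun x hx => by
    rw [Finset.sum_sub_distrib, mul_sub, hh.mul_eq hn hx, hg' x hx]; ring) x
  simp only [hh.1, hg] at h1 h2
  linarith

end Uniqueness

/-- For `e < m`, the expected time for the walk on `{1,…,n}^m` to go from distance `e + 1`
to distance `e` of the target. -/
noncomputable def descentTime (n : ℝ) : ℕ → ℕ → ℝ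
  | 0, _ => 0
  | m + 1, e => n - 1 + n * ((m : ℝ) - e) / m * descentTime n m e

lemma descentTime_zero (n : ℝ) (m : ℕ) : descentTime n m 0 = n ^ m - 1 := by
  induction m with
  | zero => simp [descentTime]
  | succ m ih =>
    rw [descentTime, ih]
    rcases eq_or_ne m 0 with rfl | hm
    · simp
    · have : (m : ℝ) ≠ 0 := by exact_mod_cast hm
      simp only [Nat.cast_zero, sub_zero]
      field_simp
      ring

lemma descentTime_last (n : ℝ) (m : ℕ) : descentTime n (m + 1) m = n - 1 := by
  simp [descentTime]

lemma descentTime_step (n : ℝ) {m e : ℕ} (he : e < m) :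
    ((e : ℝ) + 1) * descentTime n m e =
      (n - 1) * m + ((m : ℝ) - (e + 1)) * (n - 1) * descentTime n m (e + 1) := by
  induction m with
  | zero => omega
  | succ m ih =>
    rcases Nat.lt_succ_iff_lt_or_eq.mp he with hlt | rfl
    · have hm : (m : ℝ) ≠ 0 := by
        have : m ≠ 0 := by omega
        exact_mod_cast this
      have h := ih hlt
      simp only [descentTime]
      push_cast
      field_simp
      linear_combination n * ((m : ℝ) - e) * h
    · rw [descentTime_last]
      push_cast
      ring

lemma sum_descentTime_succ (n : ℝ) (m : ℕ) :
    ((m : ℝ) + 1) * ∑ e ∈ range (m + 2), descentTime n (m + 2) e =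
      ((m : ℝ) + 2) * ∑ e ∈ range (m + 1), descentTime n (m + 1) e +
        (n - 1) * ((m : ℝ) + 1) * n ^ (m + 1) := by
  have partial_sum : ∀ j ≤ m, ((m : ℝ) + 1) * ∑ e ∈ range (j + 1), descentTime n (m + 2) e =
      ((m : ℝ) + 2) * ∑ e ∈ range (j + 1), descentTime n (m + 1) e +
        (n - 1) * ((m : ℝ) + 1) * n ^ (m + 1) -
          ((j : ℝ) + 1) * descentTime n (m + 1) j := by
    have hm : (m : ℝ) + 1 ≠ 0 := by positivity
    have recur : ∀ e, ((m : ℝ) + 1) * descentTime n (m + 2) e =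
        (m + 1) * (n - 1) + n * (m + 1 - e) * descentTime n (m + 1) e := fun e => by
      rw [descentTime]
      push_cast
      field_simp
    intro j
    induction j with
    | zero =>
      intro _
      have h := recur 0
      rw [descentTime_zero n (m + 1)] at h
      simp only [zero_add, Finset.sum_range_one, descentTime_zero n (m + 1), h]
      push_cast
      ring
    | succ j ih =>
      intro hj
      have step := descentTime_step n (show j < m + 1 by omega)
      have r := recur (j + 1)
      rw [Finset.sum_range_succ, Finset.sum_range_succ _ (j + 1)]
      push_cast at step r ⊢
      linear_combination ih (by omega) + r - step
  have hlast := partial_sum m le_rfl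
  rw [Finset.sum_range_succ, mul_add, hlast, descentTime_last, descentTime_last]
  ring

lemma IsHitSol.eq_sum_descentTime {m n : ℕ} {b : Fin m → Fin n} {h : (Fin m → Fin n) → ℝ}
    (hn : 2 ≤ n) (hh : IsHitSol b h) :
    h = fun x => ∑ e ∈ range (hammingDist x b), descentTime n m e := by
  refine hh.unique hn (by simp) fun x hx => ?_
  obtain ⟨d, hd⟩ := Nat.exists_eq_succ_of_ne_zero (hammingDist_ne_zero.mpr hx)
  have hdm : d < m := by
    have := hammingDist_le_card_fintype (x := x) (y := b)
    rw [Fintype.card_fin] at this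
    omega
  rw [sum_neighbours_radial hn x b (fun d => ∑ e ∈ range d, descentTime n m e) hd, hd]
  simp only [Finset.sum_range_succ]
  linear_combination descentTime_step (n : ℝ) hdm

lemma IsHitSol.apply_const {m n : ℕ} {v w : Fin n} {h : (Fin m → Fin n) → ℝ}
    (hn : 2 ≤ n) (hvw : w ≠ v) (hh : IsHitSol (fun _ => v) h) :
    h (fun _ => w) = ∑ e ∈ range m, descentTime n m e := by
  rw [hh.eq_sum_descentTime hn]
  simp [hammingDist, hvw]

theorem stmt_19 (n k : ℕ) (hn : 2 ≤ n) (hk : 2 ≤ k)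
    (hk' : (Fin k → Fin n) → ℝ) (hk1 : (Fin (k - 1) → Fin n) → ℝ)
    (hsolk : IsHitSol (fun _ => (⟨1, by omega⟩ : Fin n)) hk')
    (hsolk1 : IsHitSol (fun _ => (⟨1, by omega⟩ : Fin n)) hk1) :
    hk' (fun _ => (⟨0, by omega⟩ : Fin n)) =
      ((k : ℝ) / ((k : ℝ) - 1)) * hk1 (fun _ => (⟨0, by omega⟩ : Fin n)) +
        ((n : ℝ) - 1) * (n : ℝ) ^ (k - 1) := by
  rw [hsolk.apply_const hn (by simp), hsolk1.apply_const hn (by simp)]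
  obtain ⟨m, rfl⟩ := Nat.exists_eq_add_of_le' hk
  have h := sum_descentTime_succ (n : ℝ) m
  have hm : (m : ℝ) + 1 ≠ 0 := by positivity
  have hm2 : ((m + 2 : ℕ) : ℝ) - 1 = m + 1 := by push_cast; ring
  rw [hm2, show m + 2 - 1 = m + 1 from rfl]
  push_cast
  field_simp
  linear_combination h
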